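/- Let m be a positive integer with distinct prime factors p_1, p_2, …, p_ℓ. If ξ_1, ξ_2, …, ξ_v ∈ ℂ are m-th roots of unity with ξ_1 + ξ_2 + ⋯ + ξ_v = 0, then there exist nonnegative integers t_1, t_2, …, t_ℓ such that v = p_1·t_1 + p_2·t_2 + ⋯ + p_ℓ·t_ℓ. -/

import Mathlib

open Finset

lemma numeric (S : AddSubmonoid ℕ) (p a B : ℕ) (hp : p ∈ S) (haB : a ≤ B) (hBp : B < p)
    (x k : Fin p → ℕ) (i0 : Fin p) (hi0 : ∀ i, k i = 0 → x i0 ≤ x i)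
    (hk : ∑ i, k i < a)
    (h : ∀ i, k i + x i0 < a → (∃ s ∈ S, x i = k i + x i0 + s) ∨
      a * B ≤ x i + (k i + x i0) * B) :
    (∃ s ∈ S, ∑ i, x i = ∑ i, k i + s) ∨ a * B ≤ ∑ i, x i + (∑ i, k i) * B := by
  by_cases hall : ∀ i, ∃ s ∈ S, x i = k i + x i0 + s
  · left
    choose s hs hxs using hall
    refine ⟨x i0 • p + ∑ i, s i, S.add_mem (S.nsmul_mem hp _) (S.sum_mem fun i _ => hs i), ?_⟩
    rw [Finset.sum_congr rfl fun i _ => hxs i]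
    simp only [Finset.sum_add_distrib, Finset.sum_const, Finset.card_univ, Fintype.card_fin,
      smul_eq_mul]
    ring
  · right
    push Not at hall
    obtain ⟨i, hi⟩ := hall
    have hlow : ∀ j, x i0 ≤ x j + x i0 * k j := by
      intro j
      rcases Nat.eq_zero_or_pos (k j) with h0 | h0
      · have := hi0 j h0; omega
      · nlinarith
    have hR : (p - 1) * x i0 ≤ ∑ j ∈ univ.erase i, x j + x i0 * ∑ j ∈ univ.erase i, k j := by
      rw [Finset.mul_sum, ← Finset.sum_add_distrib]
      have := Finset.card_nsmul_le_sum (univ.erase i) (fun j => x j + x i0 * k j) (x i0)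
        (fun j _ => hlow j)
      simpa [Finset.card_erase_of_mem] using this
    have hx := Finset.add_sum_erase univ x (Finset.mem_univ i)
    have hk' := Finset.add_sum_erase univ k (Finset.mem_univ i)
    rw [← hx]
    rw [← hk'] at hk ⊢
    generalize ∑ j ∈ univ.erase i, x j = R at *
    generalize ∑ j ∈ univ.erase i, k j = J at *
    have hR' : B * x i0 ≤ R + x i0 * J :=
      le_trans (Nat.mul_le_mul_right _ (by omega)) hR
    by_cases hc : k i + x i0 < a
    · rcases h i hc with ⟨s, hs, hs'⟩ | h2
      · exact absurd hs' (hi s hs)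
      · have : x i0 * J ≤ B * J := Nat.mul_le_mul_right _ (by omega)
        nlinarith
    · zify at *
      nlinarith [mul_nonneg (show (0:ℤ) ≤ x i0 - (a - k i) by linarith) (show (0:ℤ) ≤ B - J by linarith [show (0:ℤ) ≤ k i by positivity]),
        mul_nonneg (show (0:ℤ) ≤ J by positivity) (show (0:ℤ) ≤ B - a + k i by linarith [show (0:ℤ) ≤ k i by positivity])]

lemma decomp (p m : ℕ) (ζ : ℂ) (hd : ∀ z : ℂ, z ^ (p * m) = 1 → ∃ i : Fin p, ∃ w : ℂ, w ^ m = 1 ∧ z = ζ ^ (i : ℕ) * w)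
    (X : Multiset ℂ) (hX : ∀ z ∈ X, z ^ (p * m) = 1) :
    ∃ F : Fin p → Multiset ℂ, (∀ i, ∀ z ∈ F i, z ^ m = 1) ∧ X.card = ∑ i, (F i).card ∧
      X.sum = ∑ i : Fin p, ζ ^ (i : ℕ) * (F i).sum := by
  induction X using Multiset.induction_on with
  | empty => exact ⟨fun _ => 0, by simp⟩
  | cons z X ih =>
    obtain ⟨F, h1, h2, h3⟩ := ih fun z hz => hX z (Multiset.mem_cons_of_mem hz)
    obtain ⟨i, w, hw, rfl⟩ := hd z (hX z (Multiset.mem_cons_self _ _))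
    refine ⟨fun j => F j + if j = i then {w} else 0, ?_, ?_, ?_⟩
    · intro j z hz
      rw [Multiset.mem_add] at hz
      rcases hz with hz | hz
      · exact h1 j z hz
      · split_ifs at hz
        · rw [Multiset.mem_singleton] at hz; rwa [hz]
        · simp at hz
    · simp only [Multiset.card_cons, Multiset.card_add, Finset.sum_add_distrib, ← h2]
      simp [apply_ite]
    · simp only [Multiset.sum_cons, Multiset.sum_add, mul_add, Finset.sum_add_distrib, ← h3]
      simp [apply_ite, add_comm]

def CC (a B m : ℕ) : Prop := ∀ X Y : Multiset ℂ, (∀ z ∈ X, z ^ m = 1) → (∀ z ∈ Y, z ^ m = 1) →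
  X.sum = Y.sum → Y.card < a →
  (∃ s ∈ AddSubmonoid.closure (m.primeFactors : Set ℕ), X.card = Y.card + s) ∨
    a * B ≤ X.card + Y.card * B

noncomputable abbrev KK (m : ℕ) : IntermediateField ℚ ℂ := IntermediateField.adjoin ℚ {w : ℂ | w ^ m = 1}

lemma sum_mem_KK (m : ℕ) (X : Multiset ℂ) (hX : ∀ z ∈ X, z ^ m = 1) : X.sum ∈ KK m :=
  multiset_sum_mem _ fun z hz => IntermediateField.subset_adjoin _ _ (hX z hz)

lemma indep_small (m n : ℕ) (ζ : ℂ) (hn : n ≤ (minpoly (KK m) ζ).natDegree) (α : Fin n → ℂ)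
    (hα : ∀ i, α i ∈ KK m) (h : ∑ i : Fin n, ζ ^ (i : ℕ) * α i = 0) : ∀ i, α i = 0 := by
  have h1 := (linearIndependent_pow (K := KK m) ζ).comp (Fin.castLE hn) (Fin.castLE_injective hn)
  rw [Fintype.linearIndependent_iff] at h1
  intro i
  have := h1 (fun i => ⟨α i, hα i⟩) (by
    rw [← h]
    refine Finset.sum_congr rfl fun i _ => ?_
    simp [IntermediateField.smul_def, mul_comm]) i
  exact congrArg Subtype.val this

lemma degree_lemma (p m : ℕ) (hp : p.Prime) (hm : 0 < m) (ω ζ : ℂ)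
    (hω : IsPrimitiveRoot ω (p * m)) (hζ : ζ ^ (p * m) = 1)
    (i : ℕ) (w : ℂ) (hw : w ^ m = 1) (hωζ : ω = ζ ^ i * w) :
    (p * m).totient ≤ m.totient * (minpoly (KK m) ζ).natDegree := by
  have hN : 0 < p * m := Nat.mul_pos hp.pos hm
  have hη : IsPrimitiveRoot (ω ^ p) m := hω.pow hN rfl
  have hK : KK m = IntermediateField.adjoin ℚ {ω ^ p} := by
    apply le_antisymm
    · rw [IntermediateField.adjoin_le_iff]
      intro z hz
      obtain ⟨j, -, rfl⟩ := (haveI : NeZero m := ⟨hm.ne'⟩; hη.eq_pow_of_pow_eq_one hz)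
      exact pow_mem (IntermediateField.mem_adjoin_simple_self ℚ _) _
    · rw [IntermediateField.adjoin_le_iff, Set.singleton_subset_iff]
      exact IntermediateField.subset_adjoin _ _ hη.pow_eq_one
  have hηi : IsIntegral ℚ (ω ^ p) := (hη.isIntegral hm).tower_top
  have hKr : Module.finrank ℚ (KK m) = m.totient := by
    rw [hK, IntermediateField.adjoin.finrank hηi, ← Polynomial.cyclotomic_eq_minpoly_rat hη hm,
      Polynomial.natDegree_cyclotomic]
  have hKf : FiniteDimensional ℚ (KK m) := by
    rw [hK]; exact IntermediateField.adjoin.finiteDimensional hηi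
  have hζi : IsIntegral (KK m) ζ :=
    IsIntegral.of_pow hN (by rw [hζ]; exact isIntegral_one)
  have hLf : FiniteDimensional (KK m) (IntermediateField.adjoin (KK m) {ζ}) :=
    IntermediateField.adjoin.finiteDimensional hζi
  have hmem : ω ∈ IntermediateField.adjoin (KK m) {ζ} := by
    rw [hωζ]
    refine mul_mem (pow_mem (IntermediateField.mem_adjoin_simple_self _ _) _) ?_
    exact IntermediateField.algebraMap_mem (IntermediateField.adjoin (KK m) {ζ})
      (⟨w, IntermediateField.subset_adjoin _ _ hw⟩ : KK m)
  have hQf : FiniteDimensional ℚ (IntermediateField.adjoin (KK m) {ζ}) :=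
    FiniteDimensional.trans ℚ (KK m) _
  have h1 := minpoly.natDegree_le (A := ℚ) (⟨ω, hmem⟩ : IntermediateField.adjoin (KK m) {ζ})
  have h2 : IsPrimitiveRoot (⟨ω, hmem⟩ : IntermediateField.adjoin (KK m) {ζ}) (p * m) :=
    IsPrimitiveRoot.of_map_of_injective (f := (IntermediateField.adjoin (KK m) {ζ}).val)
      (by simpa using hω) Subtype.val_injective
  rw [← Polynomial.cyclotomic_eq_minpoly_rat h2 hN, Polynomial.natDegree_cyclotomic,
    ← Module.finrank_mul_finrank ℚ (KK m), hKr, IntermediateField.adjoin.finrank hζi] at h1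
  exact h1

lemma root_decomp (p m c : ℕ) (hp : p.Prime) (hm : 0 < m) (hc : ¬ p ∣ c) (ω : ℂ)
    (hω : IsPrimitiveRoot ω (p * m)) (z : ℂ) (hz : z ^ (p * m) = 1) :
    ∃ i : Fin p, ∃ w : ℂ, w ^ m = 1 ∧ z = (ω ^ c) ^ (i : ℕ) * w := by
  have hN : 0 < p * m := Nat.mul_pos hp.pos hm
  have : NeZero (p * m) := ⟨hN.ne'⟩
  have : Fact p.Prime := ⟨hp⟩
  obtain ⟨j, -, rfl⟩ := hω.eq_pow_of_pow_eq_one hz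
  have hω0 : ω ≠ 0 := hω.ne_zero hN.ne'
  have hc0 : (c : ZMod p) ≠ 0 := by rwa [Ne, ZMod.natCast_eq_zero_iff]
  let i : ZMod p := (j : ZMod p) * (c : ZMod p)⁻¹
  refine ⟨⟨i.val, ZMod.val_lt i⟩, ω ^ j / (ω ^ c) ^ i.val, ?_, ?_⟩
  · have hmod : c * i.val ≡ j [MOD p] := by
      rw [← ZMod.natCast_eq_natCast_iff]
      simp only [Nat.cast_mul, ZMod.natCast_val, ZMod.cast_id', id, i]
      field_simp
    have hmod2 := Nat.ModEq.mul_right' m hmod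
    rw [hω.eq_orderOf] at hmod2
    have hpow : ω ^ (c * i.val * m) = ω ^ (j * m) := by
      rw [← pow_mod_orderOf, hmod2, pow_mod_orderOf]
    rw [div_pow, ← pow_mul, ← pow_mul, ← pow_mul, ← mul_assoc, hpow, div_self (pow_ne_zero _ hω0)]
  · field_simp

lemma field_lemma (p m : ℕ) (hp : p.Prime) (hm : 0 < m) : ∃ ζ : ℂ,
    (∀ z : ℂ, z ^ (p * m) = 1 → ∃ i : Fin p, ∃ w : ℂ, w ^ m = 1 ∧ z = ζ ^ (i : ℕ) * w) ∧
    (∀ α : Fin p → ℂ, (∀ i, α i ∈ KK m) → ∑ i : Fin p, ζ ^ (i : ℕ) * α i = 0 →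
      (∀ i j, α i = α j) ∧ (p ∣ m → ∀ i, α i = 0)) := by
  have hN : 0 < p * m := Nat.mul_pos hp.pos hm
  have hω := Complex.isPrimitiveRoot_exp (p * m) hN.ne'
  generalize Complex.exp (2 * Real.pi * Complex.I / ((p * m : ℕ) : ℂ)) = ω at hω
  have hφ : 0 < m.totient := Nat.totient_pos.2 hm
  by_cases hd : p ∣ m
  · have h1 := root_decomp p m 1 hp hm (fun h => hp.one_lt.ne' (Nat.dvd_one.1 h)) ω hω
    refine ⟨ω ^ 1, h1, ?_⟩
    obtain ⟨i, w, hw, e⟩ := h1 ω hω.pow_eq_one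
    have h2 := degree_lemma p m hp hm ω (ω ^ 1) hω (by simpa using hω.pow_eq_one) i w hw e
    rw [Nat.totient_mul_of_prime_of_dvd hp hd, mul_comm] at h2
    have h3 := Nat.le_of_mul_le_mul_left h2 hφ
    intro α hα hs
    have h4 := indep_small m p _ h3 α hα hs
    exact ⟨fun i j => by rw [h4, h4], fun _ => h4⟩
  · have h1 := root_decomp p m m hp hm hd ω hω
    refine ⟨ω ^ m, h1, ?_⟩
    obtain ⟨i, w, hw, e⟩ := h1 ω hω.pow_eq_one
    have h2 := degree_lemma p m hp hm ω (ω ^ m) hω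
      (by rw [← pow_mul, mul_comm, pow_mul, hω.pow_eq_one, one_pow]) i w hw e
    rw [Nat.totient_mul_of_prime_of_not_dvd hp hd, mul_comm] at h2
    have h3 := Nat.le_of_mul_le_mul_left h2 hφ
    have hζ : IsPrimitiveRoot (ω ^ m) p := hω.pow hN (mul_comm _ _)
    have hg := hζ.geom_sum_eq_zero hp.one_lt
    generalize ω ^ m = ζ at *
    intro α hα hs
    refine ⟨?_, fun h => absurd h hd⟩
    obtain ⟨q, rfl⟩ : ∃ q, p = q + 1 := ⟨p - 1, (Nat.succ_pred_prime hp).symm⟩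
    have h4 := indep_small m q ζ (by simpa using h3) (fun i => α i.castSucc - α (Fin.last q))
      (fun i => sub_mem (hα _) (hα _)) (by
        rw [Fin.sum_univ_castSucc] at hs
        rw [Finset.sum_range_succ, ← Fin.sum_univ_eq_sum_range] at hg
        simp only [Fin.val_castSucc, Fin.val_last] at hs
        simp only [mul_sub, Finset.sum_sub_distrib, ← Finset.sum_mul]
        linear_combination hs - α (Fin.last q) * hg)
    have h5 : ∀ i, α i = α (Fin.last q) := by
      intro i
      induction i using Fin.lastCases with
      | last => rfl
      | cast i => exact sub_eq_zero.1 (h4 i)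
    intro i j
    rw [h5 i, h5 j]

lemma base1 (a B : ℕ) : CC a B 1 := by
  intro X Y hX hY h _
  left
  refine ⟨0, zero_mem _, ?_⟩
  have e : ∀ Z : Multiset ℂ, (∀ z ∈ Z, z ^ 1 = 1) → Z.sum = Z.card := by
    intro Z hZ
    have := Multiset.eq_replicate_card.2 (fun z hz => by simpa using hZ z hz : ∀ z ∈ Z, z = (1:ℂ))
    rw [this]; simp
  rw [e X hX, e Y hY] at h
  exact_mod_cast h

lemma closure_mono_dvd {m n : ℕ} (h : m ∣ n) (hn : n ≠ 0) :
    AddSubmonoid.closure (m.primeFactors : Set ℕ) ≤ AddSubmonoid.closure (n.primeFactors : Set ℕ) :=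
  AddSubmonoid.closure_mono (by exact_mod_cast Nat.primeFactors_mono h hn)

lemma split_lemma (p m : ℕ) (hp : p.Prime) (hm : 0 < m) (X Y : Multiset ℂ)
    (hX : ∀ z ∈ X, z ^ (p * m) = 1) (hY : ∀ z ∈ Y, z ^ (p * m) = 1) (h : X.sum = Y.sum) :
    ∃ F G : Fin p → Multiset ℂ, (∀ i, ∀ z ∈ F i, z ^ m = 1) ∧ (∀ i, ∀ z ∈ G i, z ^ m = 1) ∧
      X.card = ∑ i, (F i).card ∧ Y.card = ∑ i, (G i).card ∧
      (∀ i j, (F i).sum - (G i).sum = (F j).sum - (G j).sum) ∧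
      (p ∣ m → ∀ i, (F i).sum = (G i).sum) := by
  obtain ⟨ζ, h1, h2⟩ := field_lemma p m hp hm
  obtain ⟨F, f1, f2, f3⟩ := decomp p m ζ h1 X hX
  obtain ⟨G, g1, g2, g3⟩ := decomp p m ζ h1 Y hY
  obtain ⟨h3, h4⟩ := h2 (fun i => (F i).sum - (G i).sum)
    (fun i => sub_mem (sum_mem_KK m _ (f1 i)) (sum_mem_KK m _ (g1 i)))
    (by simp only [mul_sub, Finset.sum_sub_distrib]; rw [← f3, ← g3, h, sub_self])
  exact ⟨F, G, f1, g1, f2, g2, h3, fun hd i => sub_eq_zero.1 (h4 hd i)⟩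

lemma exists_zero {p : ℕ} (k : Fin p → ℕ) (h : ∑ i, k i < p) : ∃ i, k i = 0 := by
  by_contra! hc
  have := Finset.card_nsmul_le_sum univ k 1 (fun i _ => Nat.one_le_iff_ne_zero.2 (hc i))
  simp only [card_univ, Fintype.card_fin, smul_eq_mul, mul_one] at this
  exact absurd h (not_lt.2 this)

lemma stepB (a B p m : ℕ) (hp : p.Prime) (hm : 0 < m) (hd : p ∣ m) (h : CC a B m) :
    CC a B (p * m) := by
  intro X Y hX hY hs hk
  obtain ⟨F, G, f1, g1, f2, g2, -, h4⟩ := split_lemma p m hp hm X Y hX hY hs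
  have hle : ∀ i, (G i).card ≤ Y.card := fun i => by
    rw [g2]; exact Finset.single_le_sum (f := fun i => (G i).card) (fun _ _ => Nat.zero_le _) (mem_univ i)
  have hle' : ∀ i, (F i).card ≤ X.card := fun i => by
    rw [f2]; exact Finset.single_le_sum (f := fun i => (F i).card) (fun _ _ => Nat.zero_le _) (mem_univ i)
  have := fun i => h (F i) (G i) (f1 i) (g1 i) (h4 hd i) ((hle i).trans_lt hk)
  by_cases hall : ∀ i, ∃ s ∈ AddSubmonoid.closure (m.primeFactors : Set ℕ), (F i).card = (G i).card + s
  · left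
    choose s hs hxs using hall
    refine ⟨∑ i, s i, sum_mem fun i _ => closure_mono_dvd (Dvd.intro_left p rfl)
      (Nat.mul_ne_zero hp.ne_zero hm.ne') (hs i), ?_⟩
    rw [f2, g2, ← Finset.sum_add_distrib]
    exact Finset.sum_congr rfl fun i _ => hxs i
  · right
    rw [not_forall] at hall
    obtain ⟨i, hi⟩ := hall
    exact ((this i).resolve_left hi).trans (add_le_add (hle' i) (Nat.mul_le_mul_right _ (hle i)))

lemma stepA (a B p m : ℕ) (hp : p.Prime) (hm : 0 < m) (haB : a ≤ B) (hBp : B < p)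
    (h : CC a B m) : CC a B (p * m) := by
  intro X Y hX hY hs hk
  obtain ⟨F, G, f1, g1, f2, g2, h3, -⟩ := split_lemma p m hp hm X Y hX hY hs
  have hne : p * m ≠ 0 := Nat.mul_ne_zero hp.ne_zero hm.ne'
  rw [f2, g2]
  rw [g2] at hk
  obtain ⟨j, hj⟩ := exists_zero (fun i => (G i).card) (by omega)
  obtain ⟨i0, hi0, hmin⟩ := Finset.exists_min_image (univ.filter fun i => (G i).card = 0)
    (fun i => (F i).card) ⟨j, by simpa using hj⟩
  simp only [mem_filter, mem_univ, true_and] at hi0 hmin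
  refine numeric _ p a B (AddSubmonoid.subset_closure (by simp [hp, hm.ne', hp.ne_zero])) haB hBp
    (fun i => (F i).card) (fun i => (G i).card) i0 hmin hk ?_
  intro i hi
  have := h (F i) (G i + F i0) (f1 i) ?_ ?_ (by simpa using hi)
  · simp only [Multiset.card_add] at this
    refine this.imp_left ?_
    rintro ⟨s, hs, e⟩
    exact ⟨s, closure_mono_dvd (Dvd.intro_left p rfl) hne hs, e⟩
  · intro z hz
    rcases Multiset.mem_add.1 hz with hz | hz
    exacts [g1 i z hz, f1 i0 z hz]
  · have := h3 i i0
    rw [Multiset.card_eq_zero.1 hi0] at this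
    rw [Multiset.sum_add]
    simp only [Multiset.sum_zero, sub_zero] at this
    rw [← this]; ring

lemma base2 (a B : ℕ) (ha : a.Prime) : CC a B (a * 1) := by
  intro X Y hX hY hs hk
  obtain ⟨F, G, f1, g1, f2, g2, h3, -⟩ := split_lemma a 1 ha one_pos X Y hX hY hs
  have e : ∀ Z : Multiset ℂ, (∀ z ∈ Z, z ^ 1 = 1) → Z.sum = Z.card := by
    intro Z hZ
    have := Multiset.eq_replicate_card.2 (fun z hz => by simpa using hZ z hz : ∀ z ∈ Z, z = (1:ℂ))
    rw [this]; simp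
  left
  rw [f2, g2]
  rw [g2] at hk
  obtain ⟨j, hj⟩ := exists_zero (fun i => (G i).card) hk
  refine ⟨(F j).card • a, nsmul_mem (AddSubmonoid.subset_closure (by simp [ha])) _, ?_⟩
  have : ∀ i, (F i).card = (G i).card + (F j).card := by
    intro i
    have := h3 i j
    rw [e _ (f1 i), e _ (g1 i), e _ (f1 j), e _ (g1 j), hj, Nat.cast_zero, sub_zero, sub_eq_iff_eq_add] at this
    have : (F i).card = (F j).card + (G i).card := by exact_mod_cast this
    omega
  rw [Finset.sum_congr rfl fun i _ => this i]
  simp [Finset.sum_add_distrib, mul_comm]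

lemma CC_pow (a B e : ℕ) (ha : a.Prime) : CC a B (a ^ e) := by
  induction e with
  | zero => exact base1 a B
  | succ e ih =>
    rcases Nat.eq_zero_or_pos e with rfl | he
    · simpa using base2 a B ha
    · rw [pow_succ']
      exact stepB a B a _ ha (pow_pos ha.pos _) (dvd_pow_self a he.ne') ih

lemma CC_mul (a B e : ℕ) (ha : a.Prime) (haB : a ≤ B) (n : ℕ) :
    0 < n → (∀ q, q.Prime → q ∣ n → B < q) → CC a B (a ^ e * n) := by
  induction n using induction_on_primes with
  | zero => intro h; omega
  | one => intro _ _; simpa using CC_pow a B e ha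
  | prime_mul p n hp ih =>
    intro hpos hq
    have hn : 0 < n := Nat.pos_of_mul_pos_left hpos
    have := ih hn fun q h1 h2 => hq q h1 (h2.mul_left p)
    rw [mul_left_comm]
    exact stepA a B p _ hp (Nat.mul_pos (pow_pos ha.pos _) hn) haB (hq p hp (dvd_mul_right _ _)) this

lemma closure_finset (s : Finset ℕ) (n : ℕ) (h : n ∈ AddSubmonoid.closure (s : Set ℕ)) :
    ∃ t : ℕ → ℕ, n = ∑ q ∈ s, q * t q := by
  induction h using AddSubmonoid.closure_induction with
  | mem x hx => exact ⟨fun q => if q = x then 1 else 0, by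
      have hx' : x ∈ s := by exact_mod_cast hx
      simp [hx']⟩
  | zero => exact ⟨0, by simp⟩
  | add x y _ _ h1 h2 =>
    obtain ⟨t, rfl⟩ := h1
    obtain ⟨u, rfl⟩ := h2
    exact ⟨t + u, by simp [mul_add, Finset.sum_add_distrib]⟩


lemma final_aux (m : ℕ) (hm : 0 < m) (v a B : ℕ) (ha : a.Prime) (haB : a ≤ B)
    (hq : ∀ q ∈ m.primeFactors, q = a ∨ B < q) (ξ : Fin v → ℂ)
    (hroot : ∀ i, ξ i ^ m = 1) (hsum : ∑ i, ξ i = 0) :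
    v ∈ AddSubmonoid.closure (m.primeFactors : Set ℕ) ∨ a * B ≤ v := by
  obtain ⟨e, n, hn, rfl⟩ := Nat.exists_eq_pow_mul_and_not_dvd hm.ne' a ha.ne_one
  have hn0 : 0 < n := Nat.pos_of_ne_zero fun h => hn (h ▸ dvd_zero a)
  have := CC_mul a B e ha haB n hn0 (fun q h1 h2 =>
    (hq q (Nat.mem_primeFactors.2 ⟨h1, h2.mul_left _, hm.ne'⟩)).resolve_left
      fun h => hn (h ▸ h2)) (univ.val.map ξ) 0 (by simpa using hroot) (by simp)
      (by rw [Multiset.sum_zero]; exact hsum) (by simpa using ha.pos)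
  simpa using this

theorem stmt14 (m : ℕ) (hm : 0 < m) (v : ℕ) (ξ : Fin v → ℂ)
    (hroot : ∀ i, ξ i ^ m = 1) (hsum : ∑ i, ξ i = 0) :
    ∃ t : ℕ → ℕ, (v : ℕ) = ∑ q ∈ m.primeFactors, q * t q := by
  apply closure_finset
  obtain ⟨a, ha, hmin, ham⟩ : ∃ a : ℕ, a.Prime ∧ (∀ q ∈ m.primeFactors, a ≤ q) ∧
      (m = 1 ∨ a ∈ m.primeFactors) := by
    by_cases h1 : m = 1
    · exact ⟨2, Nat.prime_two, by simp [h1], Or.inl h1⟩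
    · refine ⟨m.minFac, Nat.minFac_prime h1, fun q hq => ?_, Or.inr ?_⟩
      · exact Nat.minFac_le_of_dvd (Nat.prime_of_mem_primeFactors hq).two_le
          (Nat.dvd_of_mem_primeFactors hq)
      · exact Nat.mem_primeFactors.2 ⟨Nat.minFac_prime h1, Nat.minFac_dvd m, hm.ne'⟩
  rcases (m.primeFactors.erase a).eq_empty_or_nonempty with he | he
  · refine (final_aux m hm v a (a + v) ha (by omega) (fun q hq => Or.inl ?_) ξ hroot
      hsum).resolve_right ?_
    · by_contra hne
      have : q ∈ m.primeFactors.erase a := Finset.mem_erase.2 ⟨hne, hq⟩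
      simp [he] at this
    · have := ha.two_le
      nlinarith
  · obtain ⟨b, hb, hbmin⟩ := Finset.exists_min_image _ id he
    simp only [id] at hbmin
    obtain ⟨hba, hbm⟩ := Finset.mem_erase.1 hb
    have hab : a < b := lt_of_le_of_ne (hmin b hbm) (Ne.symm hba)
    have ham' : a ∈ m.primeFactors := ham.resolve_left fun h => by simp [h] at hbm
    have hbp := Nat.prime_of_mem_primeFactors hbm
    have hq' : ∀ q ∈ m.primeFactors, q = a ∨ b - 1 < q := by
      intro q hq
      by_cases h : q = a
      · exact Or.inl h
      · have := hbmin q (Finset.mem_erase.2 ⟨h, hq⟩)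
        have := ha.two_le
        right; omega
    rcases final_aux m hm v a (b - 1) ha (by omega) hq' ξ hroot hsum with h | h
    · exact h
    · have hco : a.gcd b = 1 := (Nat.coprime_primes ha hbp).2 hab.ne
      obtain ⟨s, t, hst⟩ := Nat.exists_add_mul_eq_of_gcd_dvd_of_mul_pred_le a b v
        (by rw [hco]; exact one_dvd v)
        (le_trans (Nat.mul_le_mul_right _ (Nat.pred_le a)) h)
      rw [← hst]
      exact add_mem (nsmul_mem (AddSubmonoid.subset_closure (by exact_mod_cast ham')) s)
        (nsmul_mem (AddSubmonoid.subset_closure (by exact_mod_cast hbm)) t)
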